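/- Let a > 0 and let γ : [0,L] → ℝ² be a C² unit-speed curve with positive geodesic curvature from (a,0) to (-a,0) such that γ ⊕ [-a,a] is simple, γ'(0) = e^{-iπ/2}, and γ'(L) = e^{iθ_L} with π < θ_L ≤ 5π/2. Then the maximum k_max and minimum k_min of the geodesic curvature of γ satisfy k_min ≤ k_max / (k_max·a + 1). -/

import Mathlib

open Real Set Complex

/-- Real inner product on ℂ viewed as ℝ². -/
noncomputable def inner2 (x y : ℂ) : ℝ := x.re * y.re + x.im * y.im

/-- Signed geodesic curvature of a unit-speed planar curve (J = multiplication by I). -/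
noncomputable def curvU (γ : ℝ → ℂ) (t : ℝ) : ℝ :=
  inner2 (deriv (deriv γ) t) (Complex.I * deriv γ t)

/-- Signed geodesic curvature of a regular planar curve. -/
noncomputable def curvR (γ : ℝ → ℂ) (t : ℝ) : ℝ :=
  (‖deriv γ t‖ ^ 3)⁻¹ * inner2 (deriv (deriv γ) t) (Complex.I * deriv γ t)

/-- The closed curve γ ⊕ [-a,a]: γ on [0,L] followed by the segment from (-a,0) to (a,0). -/
noncomputable def concatSeg (γ : ℝ → ℂ) (L a : ℝ) : ℝ → ℂ :=
  fun t => if t ≤ L then γ t else Complex.ofReal (-a + (t - L))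

/-- A continuous angle with nonnegative sine cannot leave the interval `[0, π]`. -/
lemma mem_Icc_zero_pi_of_sin_nonneg {S : Set ℝ} (hS : IsPreconnected S) {f : ℝ → ℝ}
    (hf : ContinuousOn f S) (hsin : ∀ x ∈ S, 0 ≤ Real.sin (f x)) {c : ℝ} (hc : c ∈ S)
    (hfc : f c ∈ Icc 0 π) {x : ℝ} (hx : x ∈ S) : f x ∈ Icc 0 π := by
  have hpi := Real.pi_pos
  constructor
  · by_contra! h
    obtain ⟨y, hy, hfy⟩ := hS.intermediate_value hx hc hf
      (show max (f x) (-(π / 2)) ∈ Icc (f x) (f c) from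
        ⟨le_max_left _ _, max_le (by linarith [hfc.1]) (by linarith [hfc.1])⟩)
    have hneg : Real.sin (f y) < 0 := by
      rw [hfy]
      exact Real.sin_neg_of_neg_of_neg_pi_lt (max_lt h (by linarith))
        (lt_of_lt_of_le (by linarith) (le_max_right _ _))
    linarith [hsin y hy]
  · by_contra! h
    obtain ⟨y, hy, hfy⟩ := hS.intermediate_value hc hx hf
      (show min (f x) (3 * π / 2) ∈ Icc (f c) (f x) from
        ⟨le_min (by linarith [hfc.2]) (by linarith [hfc.2]), min_le_left _ _⟩)
    have hneg : 0 < Real.sin (f y - π) := by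
      rw [hfy]
      refine Real.sin_pos_of_pos_of_lt_pi (sub_pos.2 (lt_min h (by linarith))) ?_
      linarith [min_le_right (f x) (3 * π / 2)]
    rw [Real.sin_sub_pi] at hneg
    linarith [hsin y hy]

/-- A continuous function avoiding two values stays between them once it is there. -/
lemma mem_Ioo_of_ne {S : Set ℝ} (hS : IsPreconnected S) {f : ℝ → ℝ} (hf : ContinuousOn f S)
    {u v : ℝ} (hu : ∀ x ∈ S, f x ≠ u) (hv : ∀ x ∈ S, f x ≠ v) {c : ℝ} (hc : c ∈ S)
    (hfc : f c ∈ Ioo u v) {x : ℝ} (hx : x ∈ S) : f x ∈ Ioo u v := by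
  constructor
  · by_contra! h
    obtain ⟨y, hy, hfy⟩ := hS.intermediate_value hx hc hf ⟨h, hfc.1.le⟩
    exact hu y hy hfy
  · by_contra! h
    obtain ⟨y, hy, hfy⟩ := hS.intermediate_value hc hx hf ⟨hfc.2.le, h⟩
    exact hv y hy hfy

/-- A continuous function on the plane without zeros has a continuous logarithm with prescribed
value at the origin. -/
lemma exists_continuous_exp_eq {F : ℝ × ℝ → ℂ} (hF : Continuous F) (h0 : ∀ p, F p ≠ 0) {w : ℂ}
    (hw : Complex.exp w = F (0, 0)) :
    ∃ G : ℝ × ℝ → ℂ, Continuous G ∧ G (0, 0) = w ∧ ∀ p, Complex.exp (G p) = F p := by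
  obtain ⟨G, ⟨hG0, hG⟩, -⟩ := isCoveringMapOn_exp.existsUnique_continuousMap_lifts
    (⟨F, hF⟩ : C(ℝ × ℝ, ℂ)) (a₀ := (0, 0)) (e₀ := w) hw (fun p => h0 p)
  exact ⟨G, G.continuous, hG0, fun p => congrFun hG p⟩

/-- The chords of an injective unit-speed arc have a continuous angle function which extends to
the diagonal by the angle of the tangent. -/
lemma exists_chord_angle {γ : ℝ → ℂ} {L α : ℝ} (hL : 0 < L) (hγ : ContDiff ℝ 1 γ)
    (hunit : ∀ t ∈ Icc 0 L, ‖deriv γ t‖ = 1) (hinj : InjOn γ (Icc 0 L))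
    (hα : deriv γ 0 = Complex.exp (α * Complex.I)) :
    ∃ φ : ℝ × ℝ → ℝ, Continuous φ ∧ φ (0, 0) = α ∧
      (∀ t ∈ Icc 0 L, deriv γ t = Complex.exp (φ (t, t) * Complex.I)) ∧
      ∀ s ∈ Icc 0 L, ∀ t ∈ Icc 0 L, s < t → ∃ r : ℝ, 0 < r ∧
        γ t - γ s = r * Complex.exp (φ (s, t) * Complex.I) := by
  have hd : Continuous (deriv γ) := hγ.continuous_deriv le_rfl
  set F : ℝ × ℝ → ℂ := fun p => ∫ u in (0 : ℝ)..1, deriv γ ((p.2 - p.1) * u + p.1) with hFdef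
  have hFc : Continuous F := by
    apply intervalIntegral.continuous_parametric_intervalIntegral_of_continuous'
    fun_prop
  have hFchord : ∀ s t, ((t - s : ℝ) : ℂ) * F (s, t) = γ t - γ s := by
    intro s t
    have h := intervalIntegral.smul_integral_comp_mul_add (a := 0) (b := 1) (deriv γ) (t - s) s
    rw [Complex.real_smul] at h
    rw [hFdef, h, intervalIntegral.integral_deriv_eq_sub
      (fun x _ => hγ.differentiable one_ne_zero x) (hd.intervalIntegrable _ _)]
    simp
  have hFdiag : ∀ t, F (t, t) = deriv γ t := by
    intro t
    simp [hFdef]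
  have hFne : ∀ s ∈ Icc 0 L, ∀ t ∈ Icc 0 L, F (s, t) ≠ 0 := by
    intro s hs t ht h
    by_cases hst : s = t
    · subst hst
      have := hunit s hs
      rw [← hFdiag, h] at this
      simp at this
    · have h' := hFchord s t
      rw [h, mul_zero, eq_comm, sub_eq_zero] at h'
      exact hst (hinj hs ht h'.symm)
  set c : ℝ → ℝ := fun x => max 0 (min L x) with hcdef
  have hcc : Continuous c := by fun_prop
  have hcmem : ∀ x, c x ∈ Icc 0 L := fun x => ⟨le_max_left _ _, max_le hL.le (min_le_left _ _)⟩
  have hceq : ∀ x ∈ Icc 0 L, c x = x := fun x hx => by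
    simp only [hcdef, min_eq_right hx.2, max_eq_right hx.1]
  have h0mem : (0 : ℝ) ∈ Icc 0 L := ⟨le_rfl, hL.le⟩
  obtain ⟨G, hG, hG0, hGexp⟩ := exists_continuous_exp_eq
    (F := fun p => F (c p.1, c p.2)) (w := α * Complex.I) (by fun_prop)
    (fun p => hFne _ (hcmem _) _ (hcmem _)) (by simp only [hceq 0 h0mem, hFdiag, hα])
  have hGpolar : ∀ p, Complex.exp (G p) =
      (Real.exp (G p).re : ℝ) * Complex.exp ((G p).im * Complex.I) := by
    intro p
    rw [Complex.ofReal_exp, ← Complex.exp_add, Complex.re_add_im]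
  refine ⟨fun p => (G p).im, by fun_prop, by simp [hG0], ?_, ?_⟩
  · intro t ht
    have h := hGexp (t, t)
    simp only [hceq t ht, hFdiag] at h
    have hn : Real.exp (G (t, t)).re = 1 := by
      rw [← Complex.norm_exp, h, hunit t ht]
    rw [← h, hGpolar, hn]
    simp
  · intro s hs t ht hst
    refine ⟨(t - s) * Real.exp (G (s, t)).re, mul_pos (sub_pos.2 hst) (Real.exp_pos _), ?_⟩
    have h := hGexp (s, t)
    simp only [hceq t ht, hceq s hs] at h
    rw [← hFchord, ← h, hGpolar]
    push_cast
    ring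

/-- Hopf's rotation argument for an arc closed up by the segment from `γ L = -a` to `γ 0 = a`,
starting from the lowest point `γ m` of the arc. -/
lemma chord_angle_end_mem_Icc {γ : ℝ → ℂ} {L a m : ℝ} {φ : ℝ × ℝ → ℝ} (ha : 0 < a)
    (h0 : γ 0 = (a : ℂ)) (h1 : γ L = (-a : ℂ))
    (hseg : ∀ t ∈ Ioo 0 L, (γ t).im = 0 → (γ t).re ∉ Ioo (-a) a)
    (hm : m ∈ Ioo 0 L) (hmin : ∀ t ∈ Icc 0 L, (γ m).im ≤ (γ t).im) (hneg : (γ m).im < 0)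
    (hφ : Continuous φ) (hφ0 : φ (0, 0) = -(π / 2)) (hφm : Real.cos (φ (m, m)) = 1)
    (hchord : ∀ s ∈ Icc 0 L, ∀ t ∈ Icc 0 L, s < t → ∃ r : ℝ, 0 < r ∧
      γ t - γ s = r * Complex.exp (φ (s, t) * Complex.I)) :
    φ (L, L) ∈ Icc π (3 * π) := by
  have hpi := Real.pi_pos
  have hL : 0 < L := hm.1.trans hm.2
  have hm' : m ∈ Icc 0 L := Ioo_subset_Icc_self hm
  have h0m : (0 : ℝ) ∈ Icc 0 L := left_mem_Icc.2 hL.le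
  have hLm : L ∈ Icc 0 L := right_mem_Icc.2 hL.le
  have hpolar : ∀ s ∈ Icc 0 L, ∀ t ∈ Icc 0 L, s < t → ∃ r : ℝ, 0 < r ∧
      (γ t).re - (γ s).re = r * Real.cos (φ (s, t)) ∧
      (γ t).im - (γ s).im = r * Real.sin (φ (s, t)) := by
    intro s hs t ht hst
    obtain ⟨r, hr, h⟩ := hchord s hs t ht hst
    refine ⟨r, hr, ?_, ?_⟩
    · simpa [Complex.exp_ofReal_mul_I_re] using congrArg Complex.re h
    · simpa [Complex.exp_ofReal_mul_I_im] using congrArg Complex.im h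
  have hre0 : (γ 0).re = a := by simp [h0]
  have him0 : (γ 0).im = 0 := by simp [h0]
  have hreL : (γ L).re = -a := by simp [h1]
  have himL : (γ L).im = 0 := by simp [h1]
  obtain ⟨k, hk⟩ := (Real.cos_eq_one_iff _).1 hφm
  have hsinm : Real.sin (φ (m, m)) = 0 := 
    Real.sin_eq_zero_iff_cos_eq.2 (Or.inl hφm)
  have hforward : φ (m, L) - k * (2 * π) ∈ Ioo 0 π := by
    have hsin : ∀ t ∈ Icc m L, 0 ≤ Real.sin (φ (m, t)) := by
      intro t ht
      rcases ht.1.eq_or_lt with rfl | hmt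
      · exact hsinm.ge
      · have ht' : t ∈ Icc 0 L := ⟨hm.1.le.trans ht.1, ht.2⟩
        obtain ⟨r, hr, -, h⟩ := hpolar m hm' t ht' hmt
        have := hmin t ht'
        exact nonneg_of_mul_nonneg_right (by linarith) hr
    have h := mem_Icc_zero_pi_of_sin_nonneg (S := Icc m L) isPreconnected_Icc
      (f := fun t => φ (m, t) - k * (2 * π)) (by fun_prop)
      (fun t ht => by simpa [Real.sin_sub_int_mul_two_pi] using hsin t ht)
      (left_mem_Icc.2 hm.2.le) (by simp [hk, hpi.le]) (right_mem_Icc.2 hm.2.le)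
    obtain ⟨r, hr, -, hi⟩ := hpolar m hm' L hLm hm.2
    have hpos : Real.sin (φ (m, L) - k * (2 * π)) ≠ 0 := by
      rw [Real.sin_sub_int_mul_two_pi]
      intro h'
      rw [h', mul_zero] at hi
      linarith
    refine ⟨h.1.lt_of_ne fun h' => hpos ?_, h.2.lt_of_ne fun h' => hpos ?_⟩
    · rw [← h', Real.sin_zero]
    · rw [h', Real.sin_pi]
  have hbackward : k * (2 * π) - φ (0, m) ∈ Ioo 0 π := by
    have hsin : ∀ s ∈ Icc 0 m, Real.sin (φ (s, m)) ≤ 0 := by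
      intro s hs
      rcases hs.2.eq_or_lt with rfl | hsm
      · exact hsinm.le
      · have hs' : s ∈ Icc 0 L := ⟨hs.1, hs.2.trans hm.2.le⟩
        obtain ⟨r, hr, -, h⟩ := hpolar s hs' m hm' hsm
        have := hmin s hs'
        exact nonpos_of_mul_nonpos_right (by linarith) hr
    have h := mem_Icc_zero_pi_of_sin_nonneg (S := Icc 0 m) isPreconnected_Icc
      (f := fun s => k * (2 * π) - φ (s, m)) (by fun_prop)
      (fun s hs => by simpa [Real.sin_int_mul_two_pi_sub] using hsin s hs)
      (right_mem_Icc.2 hm.1.le) (by simp [hk, hpi.le]) (left_mem_Icc.2 hm.1.le)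
    obtain ⟨r, hr, -, hi⟩ := hpolar 0 h0m m hm' hm.1
    have hpos : Real.sin (k * (2 * π) - φ (0, m)) ≠ 0 := by
      rw [Real.sin_int_mul_two_pi_sub]
      intro h'
      rw [neg_eq_zero.1 h', mul_zero] at hi
      linarith
    refine ⟨h.1.lt_of_ne fun h' => hpos ?_, h.2.lt_of_ne fun h' => hpos ?_⟩
    · rw [← h', Real.sin_zero]
    · rw [h', Real.sin_pi]
  have hcross : ∀ t ∈ Ioo 0 L, ∀ j : ℤ, φ (t, L) - φ (0, t) ≠ j * (2 * π) := by
    intro t ht j hj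
    have ht' := Ioo_subset_Icc_self ht
    obtain ⟨r₁, hr₁, hx₁, hy₁⟩ := hpolar 0 h0m t ht' ht.1
    obtain ⟨r₂, hr₂, hx₂, hy₂⟩ := hpolar t ht' L hLm ht.2
    rw [sub_eq_iff_eq_add.1 hj, add_comm] at hx₂ hy₂
    rw [Real.cos_add_int_mul_two_pi] at hx₂
    rw [Real.sin_add_int_mul_two_pi] at hy₂
    have hs : Real.sin (φ (0, t)) = 0 := by
      have : (r₁ + r₂) * Real.sin (φ (0, t)) = 0 := by linarith
      exact (mul_eq_zero.1 this).resolve_left (by positivity)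
    have hc : Real.cos (φ (0, t)) < 0 := by
      have : (r₁ + r₂) * Real.cos (φ (0, t)) < 0 := by linarith
      exact neg_of_mul_neg_right this (by positivity)
    rw [hs, mul_zero] at hy₁
    refine hseg t ht (by linarith) ⟨?_, ?_⟩
    · have := mul_neg_of_pos_of_neg hr₂ hc
      linarith
    · have := mul_neg_of_pos_of_neg hr₁ hc
      linarith
  have hopen : ∀ t ∈ Ioo 0 L, φ (t, L) - φ (0, t) ∈ Ioo 0 (2 * π) := fun t ht =>
    mem_Ioo_of_ne (f := fun t => φ (t, L) - φ (0, t)) isPreconnected_Ioo (by fun_prop)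
      (fun x hx => by simpa using hcross x hx 0) (fun x hx => by simpa using hcross x hx 1) hm
      ⟨by linarith [hforward.1, hbackward.1], by linarith [hforward.2, hbackward.2]⟩ ht
  have hclosed : Icc 0 L ⊆ (fun t => φ (t, L) - φ (0, t)) ⁻¹' Icc 0 (2 * π) := by
    rw [← closure_Ioo hL.ne]
    exact closure_minimal (fun t ht => Ioo_subset_Icc_self (hopen t ht))
      (isClosed_Icc.preimage (by fun_prop))
  obtain ⟨hl0, hu0⟩ := hclosed h0m
  obtain ⟨hlL, huL⟩ := hclosed hLm
  simp only at hl0 hu0 hlL huL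
  obtain ⟨r, hr, hx, hy⟩ := hpolar 0 h0m L hLm hL
  have hs : Real.sin (φ (0, L)) = 0 :=
    (mul_eq_zero.1 (by linarith : r * Real.sin (φ (0, L)) = 0)).resolve_left hr.ne'
  have hc : Real.cos (φ (0, L)) < 0 :=
    neg_of_mul_neg_right (by linarith : r * Real.cos (φ (0, L)) < 0) hr.le
  have hlow : π / 2 < φ (0, L) := by
    by_contra! h
    linarith [Real.cos_nonneg_of_neg_pi_div_two_le_of_le (by linarith) h]
  have heq : φ (0, L) = π := by
    have h := (Real.sin_eq_zero_iff_of_lt_of_lt (x := φ (0, L) - π) (by linarith)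
      (by linarith)).1 (by rw [Real.sin_sub_pi, hs, neg_zero])
    linarith
  exact ⟨by linarith, by linarith⟩

/-- A unit-speed planar curve of class `C²` has tangent angle whose derivative is the
curvature. -/
lemma exists_tangent_angle {γ : ℝ → ℂ} {L α : ℝ} (hL : 0 < L) (hγ : ContDiff ℝ 2 γ)
    (hunit : ∀ t ∈ Icc 0 L, ‖deriv γ t‖ = 1)
    (hα : deriv γ 0 = Complex.exp (α * Complex.I)) :
    ∃ θ : ℝ → ℝ, θ 0 = α ∧ (∀ t, HasDerivAt θ (curvU γ t) t) ∧
      ∀ t ∈ Icc 0 L, deriv γ t = Complex.exp (θ t * Complex.I) := by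
  have hγ' : ContDiff ℝ 1 (deriv γ) := ((contDiff_succ_iff_deriv (n := 1)).1 hγ).2.2
  have hγ'' : Continuous (deriv (deriv γ)) := hγ'.continuous_deriv le_rfl
  have hc' : Continuous (deriv γ) := hγ'.continuous
  have hκ : Continuous (curvU γ) := by
    unfold curvU inner2
    fun_prop
  have hd : ∀ t, HasDerivAt (deriv γ) (deriv (deriv γ) t) t := fun t =>
    (hγ'.differentiable one_ne_zero t).hasDerivAt
  have hnormal : ∀ t ∈ Icc 0 L,
      deriv (deriv γ) t = (curvU γ t : ℂ) * (Complex.I * deriv γ t) := by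
    intro t ht
    have hsq : ∀ t ∈ Icc 0 L, (deriv γ t).re ^ 2 + (deriv γ t).im ^ 2 = 1 := by
      intro t ht
      have h := Complex.sq_norm (deriv γ t)
      rw [hunit t ht, Complex.normSq_apply] at h
      linarith
    have hre := (Complex.reCLM.hasFDerivAt.comp_hasDerivAt t (hd t))
    have him := (Complex.imCLM.hasFDerivAt.comp_hasDerivAt t (hd t))
    have h1 := ((hre.pow 2).add (him.pow 2)).hasDerivWithinAt (s := Icc 0 L)
    have h2 : HasDerivWithinAt (fun _ : ℝ => (1 : ℝ)) 0 (Icc 0 L) t :=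
      hasDerivWithinAt_const _ _ _
    have h3 := (uniqueDiffOn_Icc hL t ht).eq_deriv _ h1
      (h2.congr (fun x hx => by simpa using hsq x hx) (by simpa using hsq t ht))
    have h4 := hsq t ht
    simp only [Function.comp_apply, Complex.reCLM_apply, Complex.imCLM_apply] at h3
    norm_num at h3
    apply Complex.ext
    · simp only [curvU, inner2, Complex.mul_re, Complex.mul_im, Complex.ofReal_re,
        Complex.ofReal_im, Complex.I_re, Complex.I_im]
      linear_combination (-(deriv (deriv γ) t).re) * h4 + (deriv γ t).re / 2 * h3
    · simp only [curvU, inner2, Complex.mul_re, Complex.mul_im, Complex.ofReal_re,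
        Complex.ofReal_im, Complex.I_re, Complex.I_im]
      linear_combination (-(deriv (deriv γ) t).im) * h4 + (deriv γ t).im / 2 * h3
  set θ : ℝ → ℝ := fun t => α + ∫ x in (0 : ℝ)..t, curvU γ x with hθdef
  have hθ : ∀ t, HasDerivAt θ (curvU γ t) t := fun t =>
    (hκ.integral_hasStrictDerivAt 0 t).hasDerivAt.const_add α
  refine ⟨θ, by simp [hθdef], hθ, ?_⟩
  have hD : ∀ t, HasDerivAt (fun t => deriv γ t * Complex.exp (-(θ t * Complex.I)))
      (deriv (deriv γ) t * Complex.exp (-(θ t * Complex.I)) + deriv γ t *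
        (Complex.exp (-(θ t * Complex.I)) * -(curvU γ t * Complex.I))) t := fun t =>
    (hd t).mul (((hθ t).ofReal_comp.mul_const Complex.I).neg.cexp)
  have hconst := constant_of_has_deriv_right_zero (a := 0) (b := L)
    (f := fun t => deriv γ t * Complex.exp (-(θ t * Complex.I)))
    (fun t _ => (hD t).continuousAt.continuousWithinAt) (fun t ht => by
      refine ((hD t).congr_deriv ?_).hasDerivWithinAt
      rw [hnormal t (Ico_subset_Icc_self ht)]
      ring)
  intro t ht
  have h := hconst t ht
  have h0 : θ 0 = α := by simp [hθdef]
  simp only [h0, hα, ← Complex.exp_add, add_neg_cancel, Complex.exp_zero] at h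
  rw [Complex.exp_neg] at h
  field_simp at h
  exact h

/-- Horizontal displacement of an arc whose tangent angle increases from `-π/2` to at most `5π/2`
and whose radius of curvature lies between `r` and `R`. -/
lemma displacement_ge {x θ κ : ℝ → ℝ} {L r R : ℝ} (hL : 0 < L)
    (hx : ∀ t ∈ Icc 0 L, HasDerivAt x (Real.cos (θ t)) t) (hθ : ∀ t, HasDerivAt θ (κ t) t)
    (hκ : ∀ t ∈ Icc 0 L, 0 ≤ κ t) (hr : ∀ t ∈ Icc 0 L, r * κ t ≤ 1)
    (hR : ∀ t ∈ Icc 0 L, 1 ≤ R * κ t) (hR0 : 0 ≤ R) (h0 : θ 0 = -(π / 2))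
    (hlow : π / 2 ≤ θ L) (hup : θ L ≤ 5 * π / 2) :
    2 * r - 2 * R ≤ x L - x 0 := by
  have hpi := Real.pi_pos
  have hθc : Continuous θ := continuous_iff_continuousAt.2 fun t => (hθ t).continuousAt
  have hmono : MonotoneOn θ (Icc 0 L) :=
    monotoneOn_of_deriv_nonneg (convex_Icc 0 L) hθc.continuousOn
      (fun t _ => (hθ t).differentiableAt.differentiableWithinAt)
      (fun t ht => by rw [(hθ t).deriv]; exact hκ t (interior_subset ht))
  have hstep : ∀ (c u v : ℝ), 0 ≤ u → u ≤ v → v ≤ L →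
      (∀ t ∈ Icc u v, 0 ≤ Real.cos (θ t) * (1 - c * κ t)) →
      x u - c * Real.sin (θ u) ≤ x v - c * Real.sin (θ v) := by
    intro c u v hu huv hv hnn
    have hder : ∀ t ∈ Icc u v, HasDerivAt (fun t => x t - c * Real.sin (θ t))
        (Real.cos (θ t) * (1 - c * κ t)) t := fun t ht =>
      ((hx t ⟨hu.trans ht.1, ht.2.trans hv⟩).sub ((hθ t).sin.const_mul c)).congr_deriv (by ring)
    refine monotoneOn_of_deriv_nonneg (convex_Icc u v)
      (fun t ht => (hder t ht).continuousAt.continuousWithinAt)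
      (fun t ht => (hder t (interior_subset ht)).differentiableAt.differentiableWithinAt)
      (fun t ht => ?_) (left_mem_Icc.2 huv) (right_mem_Icc.2 huv) huv
    rw [(hder t (interior_subset ht)).deriv]
    exact hnn t (interior_subset ht)
  obtain ⟨t₁, ht₁, hθ₁⟩ := intermediate_value_Icc hL.le hθc.continuousOn
    (show π / 2 ∈ Icc (θ 0) (θ L) from ⟨by linarith, hlow⟩)
  obtain ⟨t₂, ht₂, hθ₂⟩ := intermediate_value_Icc ht₁.2 hθc.continuousOn
    (show min (θ L) (3 * π / 2) ∈ Icc (θ t₁) (θ L) from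
      ⟨le_min (by linarith) (by linarith), min_le_left _ _⟩)
  have ht₂' : t₂ ∈ Icc 0 L := ⟨ht₁.1.trans ht₂.1, ht₂.2⟩
  have hfirst := hstep r 0 t₁ le_rfl ht₁.1 ht₁.2 fun t ht => by
    have ht' : t ∈ Icc 0 L := ⟨ht.1, ht.2.trans ht₁.2⟩
    refine mul_nonneg (Real.cos_nonneg_of_neg_pi_div_two_le_of_le ?_ ?_) (by linarith [hr t ht'])
    · rw [← h0]; exact hmono (left_mem_Icc.2 hL.le) ht' ht.1
    · rw [← hθ₁]; exact hmono ht' ht₁ ht.2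
  have hsecond := hstep R t₁ t₂ ht₁.1 ht₂.1 ht₂.2 fun t ht => by
    have ht' : t ∈ Icc 0 L := ⟨ht₁.1.trans ht.1, ht.2.trans ht₂.2⟩
    have h₁ := hmono ht₁ ht' ht.1
    have h₂ := hmono ht' ht₂' ht.2
    have h₃ := min_le_right (θ L) (3 * π / 2)
    exact mul_nonneg_of_nonpos_of_nonpos
      (Real.cos_nonpos_of_pi_div_two_le_of_le (by linarith) (by linarith))
      (by linarith [hR t ht'])
  have hthird : x t₂ ≤ x L := by
    rcases le_total (θ L) (3 * π / 2) with h | h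
    · rw [min_eq_left h] at hθ₂
      have := hstep R t₂ L ht₂'.1 ht₂.2 le_rfl fun t ht => by
        have ht' : t ∈ Icc 0 L := ⟨ht₂'.1.trans ht.1, ht.2⟩
        have h₁ := hmono ht₂' ht' ht.1
        have h₂ := hmono ht' (right_mem_Icc.2 hL.le) ht.2
        exact mul_nonneg_of_nonpos_of_nonpos
          (Real.cos_nonpos_of_pi_div_two_le_of_le (by linarith) (by linarith))
          (by linarith [hR t ht'])
      rw [hθ₂] at this
      linarith
    · rw [min_eq_right h] at hθ₂
      have := hstep 0 t₂ L ht₂'.1 ht₂.2 le_rfl fun t ht => by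
        have ht' : t ∈ Icc 0 L := ⟨ht₂'.1.trans ht.1, ht.2⟩
        have h₁ := hmono ht₂' ht' ht.1
        have h₂ := hmono ht' (right_mem_Icc.2 hL.le) ht.2
        have h₃ : 0 ≤ Real.cos (θ t - 2 * π) :=
          Real.cos_nonneg_of_neg_pi_div_two_le_of_le (by linarith) (by linarith)
        rw [Real.cos_sub_two_pi] at h₃
        linarith
      linarith
  rw [h0, hθ₁, Real.sin_neg, Real.sin_pi_div_two] at hfirst
  rw [hθ₁, Real.sin_pi_div_two] at hsecond
  nlinarith [Real.neg_one_le_sin (θ t₂)]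

/-- Two continuous angle functions of the same direction which agree at `0` agree everywhere. -/
lemma angle_eq_of_exp_eq {θ φ : ℝ → ℝ} {L : ℝ} (hθ : Continuous θ) (hφ : Continuous φ)
    (h0 : θ 0 = φ 0)
    (h : ∀ t ∈ Icc 0 L, Complex.exp (θ t * Complex.I) = Complex.exp (φ t * Complex.I)) {t : ℝ}
    (ht : t ∈ Icc 0 L) : θ t = φ t := by
  have hmem0 : (0 : ℝ) ∈ Icc 0 L := ⟨le_rfl, ht.1.trans ht.2⟩
  have hsin : ∀ t ∈ Icc 0 L, Real.sin (θ t - φ t) = 0 := by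
    intro t ht
    have hre := congrArg Complex.re (h t ht)
    have him := congrArg Complex.im (h t ht)
    rw [Complex.exp_ofReal_mul_I_re, Complex.exp_ofReal_mul_I_re] at hre
    rw [Complex.exp_ofReal_mul_I_im, Complex.exp_ofReal_mul_I_im] at him
    rw [Real.sin_sub, hre, him]
    ring
  have h₁ := mem_Icc_zero_pi_of_sin_nonneg (S := Icc 0 L) isPreconnected_Icc
    (f := fun t => θ t - φ t) (by fun_prop) (fun t ht => (hsin t ht).ge) hmem0
    (by simp [h0, Real.pi_pos.le]) ht
  have h₂ := mem_Icc_zero_pi_of_sin_nonneg (S := Icc 0 L) isPreconnected_Icc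
    (f := fun t => φ t - θ t) (by fun_prop)
    (fun t ht => by simp only [← neg_sub (θ t), Real.sin_neg, hsin t ht, neg_zero, le_refl]) hmem0
    (by simp [h0, Real.pi_pos.le]) ht
  linarith [h₁.1, h₂.1]

/-- An arc starting downwards from the real axis and returning to it has an interior lowest point,
which lies below the axis; where the curvature is positive, the tangent there points in the
direction of the positive real axis. -/
lemma exists_lowest_point {y θ κ : ℝ → ℝ} {L : ℝ} (hL : 0 < L) (hy : Differentiable ℝ y)
    (hderiv : ∀ t ∈ Icc 0 L, deriv y t = Real.sin (θ t)) (hθ : ∀ t, HasDerivAt θ (κ t) t)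
    (hκ : ∀ t ∈ Icc 0 L, 0 < κ t) (hy0 : y 0 = 0) (hyL : y L = 0) (hθ0 : θ 0 = -(π / 2)) :
    ∃ m ∈ Ioo 0 L, (∀ t ∈ Icc 0 L, y m ≤ y t) ∧ y m < 0 ∧ Real.cos (θ m) = 1 := by
  have h0m : (0 : ℝ) ∈ Icc 0 L := left_mem_Icc.2 hL.le
  obtain ⟨m, hm, hmin⟩ := isCompact_Icc.exists_isMinOn ⟨0, h0m⟩ hy.continuous.continuousOn
  have hmin : ∀ t ∈ Icc 0 L, y m ≤ y t := fun t ht => hmin ht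
  have hneg : y m < 0 := by
    have hd := (hy 0).hasDerivAt
    rw [hderiv 0 h0m, hθ0, Real.sin_neg, Real.sin_pi_div_two] at hd
    have hev := (hd.tendsto_slope_zero_right.eventually_lt_const
      (show (-1 : ℝ) < 0 by norm_num)).and (Ioo_mem_nhdsGT hL)
    obtain ⟨t, hlt, ht⟩ := hev.exists
    rw [zero_add, hy0, sub_zero, smul_eq_mul] at hlt
    exact (hmin t (Ioo_subset_Icc_self ht)).trans_lt
      (neg_of_mul_neg_right hlt (inv_nonneg.2 ht.1.le))
  have hmI : m ∈ Ioo 0 L := by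
    refine ⟨hm.1.lt_of_ne ?_, hm.2.lt_of_ne ?_⟩
    · rintro rfl; linarith
    · rintro rfl; linarith
  have hnhds : Icc 0 L ∈ nhds m := Icc_mem_nhds hmI.1 hmI.2
  have hlocmin : IsLocalMin y m := Filter.eventually_of_mem hnhds hmin
  have hsin : Real.sin (θ m) = 0 := by rw [← hderiv m hm, hlocmin.deriv_eq_zero]
  refine ⟨m, hmI, hmin, hneg, (Real.sin_eq_zero_iff_cos_eq.1 hsin).resolve_right fun hcos => ?_⟩
  have hdd : deriv (deriv y) m = -κ m := by
    have heq : deriv y =ᶠ[nhds m] fun t => Real.sin (θ t) :=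
      Filter.eventually_of_mem hnhds hderiv
    rw [heq.deriv_eq, (hθ m).sin.deriv, hcos]
    ring
  have hlocmax : IsLocalMax y m := isLocalMax_of_deriv_deriv_neg
    (by linarith [hκ m hm]) hlocmin.deriv_eq_zero hy.continuous.continuousAt
  have hconst : y =ᶠ[nhds m] fun _ => y m := by
    filter_upwards [hlocmin, hlocmax] with t h₁ h₂ using le_antisymm h₂ h₁
  have hzero : deriv (deriv y) m = 0 := by
    rw [hconst.deriv.deriv_eq]
    simp
  linarith [hκ m hm]

theorem stmt5 (a L θL kmin kmax : ℝ) (ha : 0 < a) (hL : 0 < L) (γ : ℝ → ℂ)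
    (hγ : ContDiff ℝ 2 γ)
    (hunit : ∀ t ∈ Icc 0 L, ‖deriv γ t‖ = 1)
    (hcurv : ∀ t ∈ Icc 0 L, 0 < curvU γ t)
    (h0 : γ 0 = (a : ℂ)) (h1 : γ L = (-a : ℂ))
    (hsimple : Set.InjOn (concatSeg γ L a) (Ico 0 (L + 2 * a)))
    (hd0 : deriv γ 0 = Complex.exp ((-(π / 2) : ℂ) * Complex.I))
    (hθL : π < θL) (hθL' : θL ≤ 5 * π / 2)
    (hdL : deriv γ L = Complex.exp ((θL : ℂ) * Complex.I))
    (hmin : ∀ t ∈ Icc 0 L, kmin ≤ curvU γ t) (hmin' : ∃ t ∈ Icc 0 L, curvU γ t = kmin)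
    (hmax : ∀ t ∈ Icc 0 L, curvU γ t ≤ kmax) (hmax' : ∃ t ∈ Icc 0 L, curvU γ t = kmax) :
    kmin ≤ kmax / (kmax * a + 1) := by
  have hpi := Real.pi_pos
  have h0m : (0 : ℝ) ∈ Icc 0 L := left_mem_Icc.2 hL.le
  have hLm : L ∈ Icc 0 L := right_mem_Icc.2 hL.le
  have hα : deriv γ 0 = Complex.exp ((-(π / 2) : ℝ) * Complex.I) := by
    rw [hd0]
    push_cast
    rfl
  have hdiff : Differentiable ℝ γ := hγ.differentiable two_ne_zero
  have hinj : InjOn γ (Icc 0 L) := by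
    intro s hs t ht hst
    exact hsimple ⟨hs.1, by linarith [hs.2]⟩ ⟨ht.1, by linarith [ht.2]⟩
      (by simpa [concatSeg, hs.2, ht.2] using hst)
  have hseg : ∀ t ∈ Ioo 0 L, (γ t).im = 0 → (γ t).re ∉ Ioo (-a) a := by
    intro t ht him hre
    have h := hsimple (x₁ := t) (x₂ := L + ((γ t).re + a)) ⟨ht.1.le, by linarith [ht.2]⟩
      ⟨by linarith [hre.1], by linarith [hre.2]⟩ (by
        simp only [concatSeg]
        rw [if_pos ht.2.le, if_neg (by linarith [hre.1])]
        apply Complex.ext <;> simp [him])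
    linarith [ht.2, hre.1]
  obtain ⟨θ, hθ0, hθ, hθexp⟩ := exists_tangent_angle hL hγ hunit hα
  have hre : ∀ t ∈ Icc 0 L, HasDerivAt (fun t => (γ t).re) (Real.cos (θ t)) t := fun t ht => by
    exact (Complex.reCLM.hasFDerivAt.comp_hasDerivAt t (hdiff t).hasDerivAt).congr_deriv
      (by simp [hθexp t ht, Complex.exp_ofReal_mul_I_re])
  have him : ∀ t ∈ Icc 0 L, HasDerivAt (fun t => (γ t).im) (Real.sin (θ t)) t := fun t ht => by
    exact (Complex.imCLM.hasFDerivAt.comp_hasDerivAt t (hdiff t).hasDerivAt).congr_deriv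
      (by simp [hθexp t ht, Complex.exp_ofReal_mul_I_im])
  obtain ⟨m, hm, hlowest, hneg, hcosm⟩ := exists_lowest_point (y := fun t => (γ t).im) hL
    (Complex.imCLM.differentiable.comp hdiff) (fun t ht => (him t ht).deriv) hθ hcurv
    (by simp [h0]) (by simp [h1]) hθ0
  obtain ⟨φ, hφ, hφ0, hφexp, hchord⟩ :=
    exists_chord_angle hL (hγ.of_le one_le_two) hunit hinj hα
  have hθφ : ∀ t ∈ Icc 0 L, θ t = φ (t, t) := fun t ht =>
    angle_eq_of_exp_eq (φ := fun t => φ (t, t))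
      (continuous_iff_continuousAt.2 fun t => (hθ t).continuousAt)
      (by fun_prop) (hθ0.trans hφ0.symm) (fun t ht => (hθexp t ht).symm.trans (hφexp t ht)) ht
  have hend := chord_angle_end_mem_Icc ha h0 h1 hseg hm hlowest hneg hφ hφ0
    (by rw [← hθφ m (Ioo_subset_Icc_self hm), hcosm]) hchord
  rw [← hθφ L hLm] at hend
  have hup : θ L ≤ 5 * π / 2 := by
    obtain ⟨n, hn⟩ := Complex.exp_eq_exp_iff_exists_int.1 ((hθexp L hLm).symm.trans hdL)
    have hn' : θ L = θL + n * (2 * π) := by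
      have := congrArg Complex.im hn
      simpa using this
    have hn1 : (n : ℝ) < 1 := by
      by_contra! h
      nlinarith [hend.2]
    have hn0 : n ≤ 0 := by
      have : n < 1 := by exact_mod_cast hn1
      omega
    have hn0' : (n : ℝ) ≤ 0 := by exact_mod_cast hn0
    nlinarith
  obtain ⟨p, hp, hpmin⟩ := hmin'
  have hkmin : 0 < kmin := hpmin ▸ hcurv p hp
  have hkmax : 0 < kmax := hkmin.trans_le (hpmin ▸ hmax p hp)
  have h := displacement_ge (r := kmax⁻¹) (R := kmin⁻¹) hL hre hθ (fun t ht => (hcurv t ht).le)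
    (fun t ht => inv_mul_le_one_of_le₀ (hmax t ht) hkmax.le)
    (fun t ht => by
      rw [← inv_mul_cancel₀ hkmin.ne']
      exact mul_le_mul_of_nonneg_left (hmin t ht) (inv_nonneg.2 hkmin.le))
    (inv_nonneg.2 hkmin.le) hθ0 (by linarith [hend.1]) hup
  simp only [h0, h1, Complex.neg_re, Complex.ofReal_re] at h
  have hrad : a + kmax⁻¹ ≤ kmin⁻¹ := by linarith
  rw [le_div_iff₀ (by positivity)]
  have h' := mul_le_mul_of_nonneg_left hrad (mul_pos hkmin hkmax).le
  field_simp at h'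
  linarith
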